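/- arXiv:1310.4041 — 3 statements merged into one kernel-verified Lean document; each statement's English description precedes it below -/
import Mathlib

section
/- Let d ≥ 1 and let f : ℝ^d → ℝ be continuous. There exists a continuous function g : ℝ^d → ℝ^d such that f(z) = ⟨z, g(z)⟩ for all z ∈ ℝ^d if and only if f(0) = 0 and f is differentiable at 0. -/
open scoped RealInnerProductSpace

/-- a continuous `f : ℝ^d → ℝ` can be written as `f z = ⟨z, g z⟩` with `g`
continuous iff `f 0 = 0` and `f` is differentiable at `0`. -/
theorem stmt0 (d : ℕ) (hd : 1 ≤ d) (f : EuclideanSpace ℝ (Fin d) → ℝ)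
    (hf : Continuous f) :
    (∃ g : EuclideanSpace ℝ (Fin d) → EuclideanSpace ℝ (Fin d),
        Continuous g ∧ ∀ z, f z = ⟪z, g z⟫) ↔
      (f 0 = 0 ∧ DifferentiableAt ℝ f 0) := by
  constructor
  · rintro ⟨g, hg, h⟩
    have h0 : f 0 = 0 := by rw [h 0, inner_zero_left]
    refine ⟨h0, ?_⟩
    have key : HasFDerivAt f (innerSL ℝ (g 0)) 0 := by
      rw [hasFDerivAt_iff_isLittleO_nhds_zero, Asymptotics.isLittleO_iff]
      intro c hc
      have := Metric.continuousAt_iff.1 (hg.continuousAt (x := 0)) c hc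
      obtain ⟨δ, hδ, H⟩ := this
      filter_upwards [Metric.ball_mem_nhds 0 hδ] with z hz
      have h1 := H (Metric.mem_ball.1 hz)
      rw [dist_eq_norm] at h1
      have e : f (0 + z) - f 0 - (innerSL ℝ (g 0)) z = ⟪z, g z - g 0⟫ := by
        rw [zero_add, h0, h z, innerSL_apply_apply, inner_sub_right,
          real_inner_comm z (g 0)]
        ring
      rw [e]
      calc ‖⟪z, g z - g 0⟫‖ ≤ ‖z‖ * ‖g z - g 0‖ := norm_inner_le_norm _ _
        _ ≤ ‖z‖ * c := by gcongr
        _ = c * ‖z‖ := mul_comm _ _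
    exact key.differentiableAt
  · rintro ⟨h0, L, hL⟩
    set v := (InnerProductSpace.toDual ℝ (EuclideanSpace ℝ (Fin d))).symm L with hv
    have hLv : ∀ z, L z = ⟪z, v⟫ := by
      intro z
      rw [real_inner_comm, hv, InnerProductSpace.toDual_symm_apply]
    refine ⟨fun z => v + ((f z - ⟪z, v⟫) / ‖z‖ ^ 2) • z, ?_, ?_⟩
    · rw [continuous_iff_continuousAt]
      intro z
      by_cases hz : z = 0
      · subst hz
        rw [hasFDerivAt_iff_isLittleO_nhds_zero, Asymptotics.isLittleO_iff] at hL
        rw [Metric.continuousAt_iff']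
        intro ε hε
        filter_upwards [hL (half_pos hε)] with z hz
        rw [zero_add, h0, sub_zero, hLv] at hz
        simp only [smul_zero, add_zero, dist_eq_norm, add_sub_cancel_left]
        rw [norm_smul, norm_div, norm_pow, norm_norm]
        by_cases hz0 : z = 0
        · simpa [hz0] using hε
        · have hp : 0 < ‖z‖ := norm_pos_iff.2 hz0
          have : ‖f z - ⟪z, v⟫‖ / ‖z‖ ^ 2 * ‖z‖ = ‖f z - ⟪z, v⟫‖ / ‖z‖ := by
            field_simp
          rw [this]
          have := (div_le_iff₀ hp).2 hz
          linarith
      · have hn : ‖z‖ ^ 2 ≠ 0 := pow_ne_zero _ (norm_ne_zero_iff.2 hz)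
        have hfz := hf.continuousAt (x := z)
        have hi : ContinuousAt (fun z => ⟪z, v⟫) z := by fun_prop
        have hnn : ContinuousAt (fun z : EuclideanSpace ℝ (Fin d) => ‖z‖ ^ 2) z := by
          fun_prop
        exact continuousAt_const.add (((hfz.sub hi).div hnn hn).smul continuousAt_id)
    · intro z
      by_cases hz : z = 0
      · subst hz; simp [h0]
      · have hn : ‖z‖ ^ 2 ≠ 0 := pow_ne_zero _ (norm_ne_zero_iff.2 hz)
        simp only [inner_add_right, inner_smul_right, real_inner_self_eq_norm_sq]
        rw [div_mul_cancel₀ _ hn]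
        ring
end

section
/- Let P be a probability measure on (Ω, F), let R : Ω → (0, ∞) be F-measurable with E_P[R] = 1, and let Q be the probability measure with density R with respect to P. Let p, q > 1 be conjugate exponents. Then, with values in [0, ∞], (E_Q[R^{−p}])^{1/p} = sup over all bounded F-measurable X : Ω → ℝ with X(ω) > 0 for all ω, of E_P[X] / (E_P[R·X^q])^{1/q}. -/
open MeasureTheory
open scoped ENNReal

/-- for a probability density `R > 0` w.r.t. `P` and `Q = R·P`, with
conjugate exponents `p, q > 1`, one has (in `[0,∞]`)
`(E_Q[R^{-p}])^{1/p} = sup_X E_P[X] / (E_P[R·X^q])^{1/q}`,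
the supremum being over bounded measurable `X` with `X > 0` everywhere. -/
theorem stmt2 {Ω : Type*} [MeasurableSpace Ω] (P : Measure Ω) [IsProbabilityMeasure P]
    (R : Ω → ℝ) (hRmeas : Measurable R) (hRpos : ∀ ω, 0 < R ω)
    (hRone : ∫⁻ ω, ENNReal.ofReal (R ω) ∂P = 1)
    (Q : Measure Ω) (hQ : Q = P.withDensity (fun ω => ENNReal.ofReal (R ω)))
    (p q : ℝ) (hp : 1 < p) (hq : 1 < q) (hpq : 1 / p + 1 / q = 1) :
    (∫⁻ ω, ENNReal.ofReal (R ω ^ (-p)) ∂Q) ^ (1 / p) =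
      ⨆ (X : Ω → ℝ) (_ : Measurable X) (_ : ∃ C : ℝ, ∀ ω, X ω ≤ C) (_ : ∀ ω, 0 < X ω),
        (∫⁻ ω, ENNReal.ofReal (X ω) ∂P) /
          (∫⁻ ω, ENNReal.ofReal (R ω * X ω ^ q) ∂P) ^ (1 / q) := by
  have hp0 : 0 < p := by linarith
  have hq0 : 0 < q := by linarith
  have hconj : p.HolderConjugate q := by
    rw [Real.holderConjugate_iff]
    exact ⟨hp, by simpa using hpq⟩
  have hmul : (p - 1) * (q - 1) = 1 := by
    have := hconj.sub_one_mul_conj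
    field_simp at hpq
    nlinarith
  have hLmeas : Measurable (fun ω => ENNReal.ofReal (R ω)) := hRmeas.ennreal_ofReal
  apply le_antisymm
  · have hL : ∫⁻ ω, ENNReal.ofReal (R ω ^ (-p)) ∂Q
        = ∫⁻ ω, ENNReal.ofReal (R ω ^ (-(p - 1))) ∂P := by
      rw [hQ, lintegral_withDensity_eq_lintegral_mul _ hLmeas
        (hRmeas.pow_const _).ennreal_ofReal]
      refine lintegral_congr fun ω => ?_
      simp only [Pi.mul_apply]
      rw [← ENNReal.ofReal_mul (hRpos ω).le]
      congr 1
      rw [show -(p - 1) = 1 + -p by ring, Real.rpow_add (hRpos ω), Real.rpow_one]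
    rw [hL]
    set Y : ℕ → Ω → ℝ := fun n ω => min (R ω ^ (-(p - 1))) ((n : ℝ) + 1) with hY
    have hYpos : ∀ n ω, 0 < Y n ω := fun n ω =>
      lt_min (Real.rpow_pos_of_pos (hRpos ω) _) (by positivity)
    have hYmeas : ∀ n, Measurable (Y n) := fun n => (hRmeas.pow_const _).min measurable_const
    have hlim : Filter.Tendsto (fun n => ∫⁻ ω, ENNReal.ofReal (Y n ω) ∂P) Filter.atTop
        (nhds (∫⁻ ω, ENNReal.ofReal (R ω ^ (-(p - 1))) ∂P)) := by
      apply lintegral_tendsto_of_tendsto_of_monotone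
      · exact fun n => (hYmeas n).ennreal_ofReal.aemeasurable
      · refine Filter.Eventually.of_forall fun ω m n hmn => ?_
        apply ENNReal.ofReal_le_ofReal
        have : (m : ℝ) ≤ n := by exact_mod_cast hmn
        exact min_le_min le_rfl (by linarith)
      · refine Filter.Eventually.of_forall fun ω => ?_
        apply tendsto_const_nhds.congr'
        obtain ⟨N, hN⟩ := exists_nat_ge (R ω ^ (-(p - 1)))
        filter_upwards [Filter.eventually_ge_atTop N] with n hn
        have : (N : ℝ) ≤ n := by exact_mod_cast hn
        simp only [hY]
        rw [min_eq_left (by linarith)]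
    refine le_of_tendsto' ((ENNReal.continuous_rpow_const (y := 1 / p)).continuousAt.tendsto.comp hlim)
      fun n => ?_
    refine le_trans ?_ (le_iSup_of_le (Y n) (le_iSup_of_le (hYmeas n)
      (le_iSup_of_le ⟨(n : ℝ) + 1, fun ω => min_le_right _ _⟩ (le_iSup_of_le (hYpos n) le_rfl))))
    simp only [Function.comp]
    have hle : ∫⁻ ω, ENNReal.ofReal (R ω * Y n ω ^ q) ∂P ≤ ∫⁻ ω, ENNReal.ofReal (Y n ω) ∂P := by
      refine lintegral_mono fun ω => ENNReal.ofReal_le_ofReal ?_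
      have h1 : Y n ω ^ (q - 1) ≤ (R ω)⁻¹ := by
        calc Y n ω ^ (q - 1) ≤ (R ω ^ (-(p - 1))) ^ (q - 1) :=
              Real.rpow_le_rpow (hYpos n ω).le (min_le_left _ _) (by linarith)
          _ = (R ω)⁻¹ := by
              rw [← Real.rpow_mul (hRpos ω).le, neg_mul, hmul, Real.rpow_neg_one]
      have h2 : Y n ω ^ q = Y n ω ^ (q - 1) * Y n ω := by
        rw [← Real.rpow_add_one (hYpos n ω).ne']; congr 1; ring
      rw [h2, ← mul_assoc]
      have h3 : R ω * Y n ω ^ (q - 1) ≤ 1 := by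
        calc _ ≤ R ω * (R ω)⁻¹ := mul_le_mul_of_nonneg_left h1 (hRpos ω).le
          _ = 1 := mul_inv_cancel₀ (hRpos ω).ne'
      calc _ ≤ 1 * Y n ω := mul_le_mul_of_nonneg_right h3 (hYpos n ω).le
        _ = _ := one_mul _
    set a := ∫⁻ ω, ENNReal.ofReal (Y n ω) ∂P with ha
    have ha0 : a ≠ 0 := by
      rw [ha, Ne, lintegral_eq_zero_iff (hYmeas n).ennreal_ofReal]
      intro h
      have : ∀ᵐ ω ∂P, False := by
        filter_upwards [h] with ω hω
        have := hYpos n ω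
        simp at hω
        linarith
      simp at this
      exact IsProbabilityMeasure.ne_zero P this
    have hat : a ≠ ⊤ := by
      refine ne_top_of_le_ne_top (b := ENNReal.ofReal ((n : ℝ) + 1)) ENNReal.ofReal_ne_top ?_
      calc a ≤ ∫⁻ ω, ENNReal.ofReal ((n : ℝ) + 1) ∂P :=
            lintegral_mono fun ω => ENNReal.ofReal_le_ofReal (min_le_right _ _)
        _ = _ := by simp
    calc a ^ (1 / p) = a / a ^ (1 / q) := by
          rw [show 1 / p = 1 - 1 / q by linarith, ENNReal.rpow_sub _ _ ha0 hat, ENNReal.rpow_one]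
      _ ≤ _ := ENNReal.div_le_div_left (ENNReal.rpow_le_rpow hle (by positivity)) _
  · refine iSup_le fun X => iSup_le fun hX => iSup_le fun _ => iSup_le fun hXpos => ?_
    apply ENNReal.div_le_of_le_mul
    have hRinv : Measurable (fun ω => ENNReal.ofReal (R ω)⁻¹) := hRmeas.inv.ennreal_ofReal
    have h1 : ∫⁻ ω, ENNReal.ofReal (X ω) ∂P
        = ∫⁻ ω, ((fun ω => ENNReal.ofReal (R ω)⁻¹) * fun ω => ENNReal.ofReal (X ω)) ω ∂Q := by
      rw [hQ, lintegral_withDensity_eq_lintegral_mul _ hLmeas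
        (hRinv.mul hX.ennreal_ofReal)]
      refine lintegral_congr fun ω => ?_
      simp only [Pi.mul_apply]
      have := hRpos ω
      rw [← mul_assoc, ← ENNReal.ofReal_mul this.le, mul_inv_cancel₀ this.ne']
      simp
    have h2 : ∫⁻ ω, ENNReal.ofReal (R ω * X ω ^ q) ∂P = ∫⁻ ω, ENNReal.ofReal (X ω) ^ q ∂Q := by
      rw [hQ, lintegral_withDensity_eq_lintegral_mul _ hLmeas (hX.ennreal_ofReal.pow_const _)]
      refine lintegral_congr fun ω => ?_
      simp only [Pi.mul_apply]
      rw [ENNReal.ofReal_mul (hRpos ω).le, ENNReal.ofReal_rpow_of_pos (hXpos ω)]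
    have h3 : ∫⁻ ω, ENNReal.ofReal (R ω ^ (-p)) ∂Q = ∫⁻ ω, ENNReal.ofReal (R ω)⁻¹ ^ p ∂Q := by
      refine lintegral_congr fun ω => ?_
      rw [ENNReal.ofReal_rpow_of_pos (inv_pos.2 (hRpos ω)), Real.inv_rpow (hRpos ω).le,
        Real.rpow_neg (hRpos ω).le]
    rw [h1, h2, h3]
    exact ENNReal.lintegral_mul_le_Lp_mul_Lq Q hconj hRmeas.inv.ennreal_ofReal.aemeasurable
      hX.ennreal_ofReal.aemeasurable
end

section
/- Let (Ω, F, P) be a probability space with a filtration (F_t)_{t∈[0,T]}, and for a jointly measurable process Z : Ω × [0,T] → ℝ^d define its BMO norm by ‖Z‖²_{BMO(P)} := sup_{t∈[0,T]} essSup_ω E_P[ ∫_t^T |Z_s|² ds | F_t ](ω) (a value in [0,∞]). Let (Z^n)_{n∈ℕ} and Z be jointly measurable ℝ^d-valued processes on Ω × [0,T] such that Z^n → Z in measure with respect to the product measure P ⊗ λ_{[0,T]}. Then ‖Z‖_{BMO(P)} ≤ liminf_{n→∞} ‖Z^n‖_{BMO(P)}. -/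
open MeasureTheory Filter
open scoped ENNReal

/-- The square of the BMO norm of a process `Z : [0,T] × Ω → ℝ^d`:
`‖Z‖²_{BMO(P)} = sup_{t∈[0,T]} essSup_ω E_P[∫_t^T |Z_s|² ds | F_t]`, expressed via its
dual characterization as the least `c ∈ [0,∞]` such that
`∫_A ∫_t^T |Z_s|² ds dP ≤ c·P(A)` for all `t ∈ [0,T]` and all `A ∈ F_t`. -/
noncomputable def bmoNormSq {Ω : Type*} {m0 : MeasurableSpace Ω} (P : Measure Ω)
    (ℱ : Filtration ℝ m0) (T : ℝ) (d : ℕ)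
    (Z : ℝ → Ω → EuclideanSpace ℝ (Fin d)) : ℝ≥0∞ :=
  sInf {c : ℝ≥0∞ | ∀ t ∈ Set.Icc (0 : ℝ) T, ∀ A : Set Ω, MeasurableSet[ℱ t] A →
    ∫⁻ ω in A, (∫⁻ s in Set.Icc t T, (‖Z s ω‖₊ : ℝ≥0∞) ^ 2) ∂P ≤ c * P A}

/-- Fatou property of the BMO norm.  If `Z^n → Z` in measure with respect
to `P ⊗ λ_{[0,T]}`, then `‖Z‖_{BMO(P)} ≤ liminf_n ‖Z^n‖_{BMO(P)}`. -/
theorem stmt14 {Ω : Type*} {m0 : MeasurableSpace Ω} (P : Measure Ω) [IsProbabilityMeasure P]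
    (T : ℝ) (hT : 0 < T) (ℱ : Filtration ℝ m0) (d : ℕ)
    (Z : ℕ → ℝ → Ω → EuclideanSpace ℝ (Fin d))
    (Zlim : ℝ → Ω → EuclideanSpace ℝ (Fin d))
    (hZmeas : ∀ n, Measurable (fun x : Ω × ℝ => Z n x.2 x.1))
    (hZlimmeas : Measurable (fun x : Ω × ℝ => Zlim x.2 x.1))
    (hconv : TendstoInMeasure (P.prod (volume.restrict (Set.Icc (0 : ℝ) T)))
      (fun n (x : Ω × ℝ) => Z n x.2 x.1) atTop (fun x : Ω × ℝ => Zlim x.2 x.1)) :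
    bmoNormSq P ℱ T d Zlim ^ (1 / 2 : ℝ) ≤
      liminf (fun n => bmoNormSq P ℱ T d (Z n) ^ (1 / 2 : ℝ)) atTop := by
  classical
  refine le_of_forall_gt_imp_ge_of_dense fun b hb => ?_
  have hfreq := frequently_lt_of_liminf_lt (by isBoundedDefault) hb
  obtain ⟨φ, hφ, hφb⟩ := extraction_of_frequently_atTop hfreq
  have hconv' : TendstoInMeasure (P.prod (volume.restrict (Set.Icc (0 : ℝ) T)))
      (fun n (x : Ω × ℝ) => Z (φ n) x.2 x.1) atTop (fun x : Ω × ℝ => Zlim x.2 x.1) :=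
    fun ε hε => (hconv ε hε).comp hφ.tendsto_atTop
  obtain ⟨ψ, hψ, hae⟩ := hconv'.exists_seq_tendsto_ae
  have key : bmoNormSq P ℱ T d Zlim ≤ b ^ (2 : ℝ) := by
    refine sInf_le ?_
    intro t ht A hA
    have hle : (P.restrict A).prod (volume.restrict (Set.Icc t T)) ≤
        P.prod (volume.restrict (Set.Icc (0 : ℝ) T)) := by
      have h0 : volume.restrict (Set.Icc t T) =
          (volume.restrict (Set.Icc (0 : ℝ) T)).restrict (Set.Icc t T) := by
        rw [Measure.restrict_restrict measurableSet_Icc,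
          Set.inter_eq_left.2 (Set.Icc_subset_Icc_left ht.1)]
      rw [h0, Measure.prod_restrict]
      exact Measure.restrict_le_self
    have hae' := ae_mono hle hae
    have hmeas : ∀ W : ℝ → Ω → EuclideanSpace ℝ (Fin d),
        Measurable (fun x : Ω × ℝ => W x.2 x.1) →
        Measurable (fun x : Ω × ℝ => (‖W x.2 x.1‖₊ : ℝ≥0∞) ^ 2) := by
      intro W hW
      exact (hW.nnnorm.coe_nnreal_ennreal).pow_const 2
    have hprod : ∀ W : ℝ → Ω → EuclideanSpace ℝ (Fin d),
        Measurable (fun x : Ω × ℝ => W x.2 x.1) →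
        ∫⁻ ω in A, (∫⁻ s in Set.Icc t T, (‖W s ω‖₊ : ℝ≥0∞) ^ 2) ∂P =
        ∫⁻ x, (‖W x.2 x.1‖₊ : ℝ≥0∞) ^ 2
          ∂((P.restrict A).prod (volume.restrict (Set.Icc t T))) := by
      intro W hW
      rw [lintegral_prod _ (hmeas W hW).aemeasurable]
    have hbound : ∀ n, ∫⁻ x, (‖Z (φ n) x.2 x.1‖₊ : ℝ≥0∞) ^ 2
          ∂((P.restrict A).prod (volume.restrict (Set.Icc t T))) ≤ b ^ (2 : ℝ) * P A := by
      intro n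
      rw [← hprod _ (hZmeas _)]
      have h1 : bmoNormSq P ℱ T d (Z (φ n)) < b ^ (2 : ℝ) := by
        have h2 := ENNReal.rpow_lt_rpow (hφb n) (show (0 : ℝ) < 2 by norm_num)
        rw [← ENNReal.rpow_mul] at h2
        norm_num at h2
        simpa using h2
      obtain ⟨c, hc, hcb⟩ := sInf_lt_iff.1 h1
      exact (hc t ht A hA).trans (by gcongr)
    rw [hprod _ hZlimmeas]
    calc _ = ∫⁻ x, liminf (fun n => (‖Z (φ (ψ n)) x.2 x.1‖₊ : ℝ≥0∞) ^ 2) atTop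
          ∂((P.restrict A).prod (volume.restrict (Set.Icc t T))) := by
          refine lintegral_congr_ae ?_
          filter_upwards [hae'] with x hx
          refine (Tendsto.liminf_eq ?_).symm
          exact ENNReal.Tendsto.pow (ENNReal.tendsto_coe.2 hx.nnnorm)
      _ ≤ liminf (fun n => ∫⁻ x, (‖Z (φ (ψ n)) x.2 x.1‖₊ : ℝ≥0∞) ^ 2
          ∂((P.restrict A).prod (volume.restrict (Set.Icc t T)))) atTop :=
          lintegral_liminf_le fun n => hmeas _ (hZmeas _)
      _ ≤ liminf (fun _ : ℕ => b ^ (2 : ℝ) * P A) atTop :=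
          liminf_le_liminf (Eventually.of_forall fun n => hbound (ψ n))
      _ = _ := liminf_const _
  have h3 := ENNReal.rpow_le_rpow key (show (0 : ℝ) ≤ 1 / 2 by norm_num)
  rw [← ENNReal.rpow_mul] at h3
  norm_num at h3
  simpa using h3
end
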